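/- Let A be a standard C*-algebra on a Hilbert space H, let E be an inner product A-module, and let T : E → E be a nonzero local mapping such that for all x, y ∈ E, ⟨x, y⟩ = 0 implies ⟨T(x), y⟩ = 0. Then there exists γ ∈ ℂ such that T(x) = γ·x for all x ∈ E. -/

import Mathlib

/-- An inner product module over a C*-algebra `A`: a (left) `A`-module `E` together with an
`A`-valued inner product which is `ℂ`-linear and `A`-linear in the first variable, conjugate
symmetric, and positive definite. -/
structure CStarInnerProductModule (A E : Type*) [NonUnitalCStarAlgebra A]
    [PartialOrder A] [StarOrderedRing A]
    [AddCommGroup E] [Module ℂ E] [SMul A E] where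
  inner : E → E → A
  add_left : ∀ x y z : E, inner (x + y) z = inner x z + inner y z
  smulC_left : ∀ (c : ℂ) (x y : E), inner (c • x) y = c • inner x y
  smulA_left : ∀ (a : A) (x y : E), inner (a • x) y = a * inner x y
  star_inner : ∀ x y : E, star (inner x y) = inner y x
  inner_self_nonneg : ∀ x : E, 0 ≤ inner x x
  inner_self_eq_zero : ∀ x : E, inner x x = 0 ↔ x = 0
  smul_add : ∀ (a : A) (x y : E), a • (x + y) = a • x + a • y
  add_smul : ∀ (a b : A) (x : E), (a + b) • x = a • x + b • x
  mul_smul : ∀ (a b : A) (x : E), (a * b) • x = a • (b • x)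
  smul_assoc : ∀ (c : ℂ) (a : A) (x : E), (c • a) • x = c • (a • x)

namespace CStarInnerProductModule

section

variable {A E : Type*} [NonUnitalCStarAlgebra A] [PartialOrder A] [StarOrderedRing A]
  [AddCommGroup E] [Module ℂ E] [SMul A E]

theorem smul_sub (ME : CStarInnerProductModule A E) (a : A) (x y : E) :
    a • (x - y) = a • x - a • y := by
  have h := ME.smul_add a (x - y) y
  rw [sub_add_cancel] at h
  exact eq_sub_of_add_eq h.symm

theorem sub_smul (ME : CStarInnerProductModule A E) (a b : A) (x : E) :
    (a - b) • x = a • x - b • x := by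
  have h := ME.add_smul (a - b) b x
  rw [sub_add_cancel] at h
  exact eq_sub_of_add_eq h.symm

theorem inner_sub_left (ME : CStarInnerProductModule A E) (x y z : E) :
    ME.inner (x - y) z = ME.inner x z - ME.inner y z := by
  have h := ME.add_left (x - y) y z
  rw [sub_add_cancel] at h
  exact eq_sub_of_add_eq h.symm

theorem inner_zero_left (ME : CStarInnerProductModule A E) (y : E) : ME.inner 0 y = 0 := by
  simpa using ME.inner_sub_left 0 0 y

theorem inner_smulA_right (ME : CStarInnerProductModule A E) (a : A) (x y : E) :
    ME.inner x (a • y) = ME.inner x y * star a := by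
  rw [← ME.star_inner, ME.smulA_left, star_mul, ME.star_inner]

theorem inner_eq_zero_symm (ME : CStarInnerProductModule A E) {x y : E}
    (h : ME.inner x y = 0) : ME.inner y x = 0 := by
  rw [← ME.star_inner, h, star_zero]

theorem ext_inner (ME : CStarInnerProductModule A E) {x y : E}
    (h : ∀ z, ME.inner x z = ME.inner y z) : x = y := by
  rw [← sub_eq_zero, ← ME.inner_self_eq_zero, ME.inner_sub_left, h, sub_self]

theorem smul_smulC_comm (ME : CStarInnerProductModule A E) (a : A) (c : ℂ) (x : E) :
    a • (c • x) = c • (a • x) :=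
  ME.ext_inner fun z => by
    rw [ME.smulA_left, ME.smulC_left, ME.smulC_left, ME.smulA_left, mul_smul_comm]

theorem eq_zero_of_forall_smul_eq_zero (ME : CStarInnerProductModule A E) {x : E}
    (h : ∀ a : A, a • x = 0) : x = 0 := by
  rw [← ME.inner_self_eq_zero, ← CStarRing.star_mul_self_eq_zero_iff, ← ME.smulA_left, h,
    ME.inner_zero_left]

/-- A local map commutes with every nonzero multiple of an idempotent. -/
theorem local_map_smul_of_mul_self_eq_smul (ME : CStarInnerProductModule A E) (T : E →ₗ[ℂ] E)
    (hT : ∀ (a : A) (x : E), a • x = 0 → a • T x = 0) {q : A} {c : ℂ} (hc : c ≠ 0)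
    (hq : q * q = c • q) (x : E) : T (q • x) = q • T x := by
  have h₁ : c • (q • T x) = q • T (q • x) := by
    have h := hT q (c • x - q • x) (by
      rw [ME.smul_sub, ME.smul_smulC_comm, ← ME.mul_smul, hq, ME.smul_assoc, sub_self])
    rwa [map_sub, map_smul, ME.smul_sub, ME.smul_smulC_comm, sub_eq_zero] at h
  have h₂ : c • T (q • x) - q • T (q • x) = 0 := by
    refine ME.eq_zero_of_forall_smul_eq_zero fun a => ?_
    have h := hT (c • a - a * q) (q • x) (by
      rw [ME.sub_smul, ← ME.mul_smul, ← ME.mul_smul, mul_assoc, hq, smul_mul_assoc,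
        mul_smul_comm, sub_self])
    rwa [ME.sub_smul, ME.smul_assoc, ME.mul_smul, ← ME.smul_smulC_comm, ← ME.smul_sub] at h
  rw [← h₁, ← _root_.smul_sub, smul_eq_zero_iff_right hc, sub_eq_zero] at h₂
  exact h₂

/-- On the range of a self-adjoint idempotent `p` with `p A p = ℂ p`, a linear map that
preserves this range and orthogonality is a scalar. -/
theorem exists_eq_smul_of_forall_mul_mul_eq_smul (ME : CStarInnerProductModule A E)
    (T : E →ₗ[ℂ] E) (hT : ∀ x y : E, ME.inner x y = 0 → ME.inner (T x) y = 0) {p : A}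
    (hpstar : star p = p) (hp : ∀ b : A, ∃ r : ℂ, p * b * p = r • p)
    (hTp : ∀ x : E, p • x = x → p • T x = T x) :
    ∃ γ : ℂ, ∀ x : E, p • x = x → T x = γ • x := by
  have hs : ∀ x y : E, p • x = x → p • y = y → ∃ r : ℂ, ME.inner x y = r • p := by
    intro x y hx hy
    obtain ⟨r, hr⟩ := hp (ME.inner x y)
    refine ⟨r, ?_⟩
    have h := ME.inner_smulA_right p x y
    rw [hy, hpstar] at h
    rw [← hr, ← ME.smulA_left, hx, ← h]
  have hproj : ∀ x y : E, p • x = x → p • y = y → x ≠ 0 →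
      ∃ r : ℂ, ME.inner (y - r • x) x = 0 := by
    intro x y hx hy hx0
    obtain ⟨s, hs'⟩ := hs x x hx hx
    obtain ⟨t, ht⟩ := hs y x hy hx
    have hs0 : s ≠ 0 := by
      rintro rfl
      rw [zero_smul, ME.inner_self_eq_zero] at hs'
      exact hx0 hs'
    refine ⟨t / s, ?_⟩
    rw [ME.inner_sub_left, ME.smulC_left, hs', ht, smul_smul, div_mul_cancel₀ _ hs0, sub_self]
  have heig : ∀ x : E, p • x = x → ∃ r : ℂ, T x = r • x := by
    intro x hx
    by_cases hx0 : x = 0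
    · exact ⟨0, by simp [hx0]⟩
    obtain ⟨r, hr⟩ := hproj x (T x) hx (hTp x hx) hx0
    refine ⟨r, ?_⟩
    have hy := hT x _ (ME.inner_eq_zero_symm hr)
    rw [← sub_eq_zero, ← ME.inner_self_eq_zero, ME.inner_sub_left, hy, ME.smulC_left,
      ME.inner_eq_zero_symm hr, smul_zero, sub_zero]
  by_cases hV : ∃ x₀ : E, p • x₀ = x₀ ∧ x₀ ≠ 0
  · obtain ⟨x₀, hx₀, hne⟩ := hV
    obtain ⟨γ, hγ⟩ := heig x₀ hx₀
    refine ⟨γ, fun x hx => ?_⟩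
    obtain ⟨r, hr⟩ := hproj x₀ x hx₀ hx hne
    set y := x - r • x₀ with hy
    have hyp : p • y = y := by rw [hy, ME.smul_sub, ME.smul_smulC_comm, hx, hx₀]
    obtain ⟨β, hβ⟩ := heig y hyp
    obtain ⟨δ, hδ⟩ := heig (y + x₀) (by rw [ME.smul_add, hyp, hx₀])
    rw [map_add, hβ, hγ] at hδ
    have hγδ : γ = δ := by
      have h := congrArg (fun v => ME.inner v x₀) hδ
      simp only [ME.add_left, ME.smulC_left, hr, smul_zero, zero_add] at h
      exact smul_left_injective ℂ (mt (ME.inner_self_eq_zero x₀).1 hne) h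
    rw [← hγδ, _root_.smul_add, add_left_inj] at hδ
    have hxy : x = y + r • x₀ := by rw [hy, sub_add_cancel]
    rw [hxy, map_add, map_smul, hβ, hγ, hδ, _root_.smul_add, smul_comm]
  · push Not at hV
    exact ⟨0, fun x hx => by simp [hV x hx]⟩

end

end CStarInnerProductModule

theorem InnerProductSpace.isCompactOperator_rankOne {H : Type*} [NormedAddCommGroup H]
    [InnerProductSpace ℂ H] (u v : H) :
    IsCompactOperator (InnerProductSpace.rankOne ℂ u v) := by
  rw [InnerProductSpace.rankOne_def']
  exact (isCompactOperator_of_locallyCompactSpace_dom (innerSL ℂ v)).clm_comp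
    (ContinuousLinearMap.toSpanSingleton ℂ u)

/-- **Corollary 3.10**: let `A` be a standard C*-algebra on a Hilbert space `H` (realized via an
isometric star homomorphism `π : A → B(H)` whose range contains all compact operators), let
`E` be an inner product `A`-module, and let `T : E → E` be a nonzero local mapping such that
`⟪x, y⟫ = 0` implies `⟪T x, y⟫ = 0`.  Then `T` is multiplication by some scalar `γ ∈ ℂ`. -/
theorem standard_orthogonality_preserving_local_is_scalar
    {H : Type*} [NormedAddCommGroup H] [InnerProductSpace ℂ H] [CompleteSpace H]
    {A E : Type*} [NonUnitalCStarAlgebra A] [PartialOrder A] [StarOrderedRing A]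
    (π : A →⋆ₙₐ[ℂ] (H →L[ℂ] H)) (hπ : Isometry π)
    (hcpt : ∀ f : H →L[ℂ] H, IsCompactOperator (⇑f) → f ∈ Set.range π)
    [AddCommGroup E] [Module ℂ E] [SMul A E]
    (ME : CStarInnerProductModule A E)
    (T : E → E) (hT : T ≠ 0)
    (hTadd : ∀ x y : E, T (x + y) = T x + T y)
    (hTsmulC : ∀ (c : ℂ) (x : E), T (c • x) = c • T x)
    (hTlocal : ∀ (a : A) (x : E), a • x = 0 → a • T x = 0)
    (hTS : ∀ x y : E, ME.inner x y = 0 → ME.inner (T x) y = 0) :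
    ∃ γ : ℂ, ∀ x : E, T x = γ • x := by
  have hinj : ∀ b : A, π b = 0 → b = 0 := fun b hb => hπ.injective (hb.trans (map_zero π).symm)
  rcases subsingleton_or_nontrivial H with hH | hH
  · exact ⟨0, fun x => ME.ext_inner fun z => hπ.injective (Subsingleton.elim _ _)⟩
  have hθ : ∀ u v : H, ∃ a : A, π a = InnerProductSpace.rankOne ℂ u v := fun u v =>
    hcpt _ (InnerProductSpace.isCompactOperator_rankOne u v)
  choose θ hθ using hθ
  let S : E →ₗ[ℂ] E := { toFun := T, map_add' := hTadd, map_smul' := hTsmulC }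
  have hθθ : ∀ u v : H, θ u v * θ u v = (inner ℂ v u) • θ u v := fun u v =>
    hπ.injective <| by ext h; simp [hθ, smul_smul, mul_comm]
  have hcomm_of_ne : ∀ u v : H, inner ℂ v u ≠ 0 → ∀ x, T (θ u v • x) = θ u v • T x :=
    fun u v huv => ME.local_map_smul_of_mul_self_eq_smul S hTlocal huv (hθθ u v)
  obtain ⟨e, he⟩ := exists_norm_eq H zero_le_one
  have he0 : e ≠ 0 := fun h0 => by simp [h0] at he
  have hcomm : ∀ v x, T (θ e v • x) = θ e v • T x := by
    intro v x
    by_cases hv : inner ℂ v e = 0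
    · have hsub : θ e v = θ e (v + e) - θ e e :=
        hπ.injective <| by ext h; simp [hθ]
      have h := map_sub S (θ e (v + e) • x) (θ e e • x)
      change T _ = T _ - T _ at h
      rw [hsub, ME.sub_smul, ME.sub_smul, h, hcomm_of_ne, hcomm_of_ne]
      · simp [he0]
      · simp [hv, he0]
    · exact hcomm_of_ne e v hv x
  have hpstar : star (θ e e) = θ e e := hπ.injective <| by
    rw [map_star, hθ, ContinuousLinearMap.star_eq_adjoint, InnerProductSpace.adjoint_rankOne]
  have hpp : ∀ v, θ e e * θ e v = θ e v := fun v => hπ.injective <| by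
    ext h; simp [hθ, he]
  have hpbp : ∀ b : A, ∃ r : ℂ, θ e e * b * θ e e = r • θ e e := fun b =>
    ⟨inner ℂ e (π b e), hπ.injective <| by ext h; simp [hθ, smul_smul, mul_comm]⟩
  obtain ⟨γ, hγ⟩ := ME.exists_eq_smul_of_forall_mul_mul_eq_smul S hTS hpstar hpbp
    fun x hx => by
      change θ e e • T x = T x
      rw [← hcomm, hx]
  refine ⟨γ, fun x => ?_⟩
  rw [← sub_eq_zero, ← ME.inner_self_eq_zero]
  refine hinj _ (ContinuousLinearMap.ext fun h => ext_inner_left ℂ fun v => ?_)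
  have hz : θ e v • (T x - γ • x) = 0 := by
    have h := hγ (θ e v • x) (by rw [← ME.mul_smul, hpp])
    change T _ = _ at h
    rw [ME.smul_sub, ME.smul_smulC_comm, ← hcomm, h, sub_self]
  have hb : π (θ e v * ME.inner (T x - γ • x) (T x - γ • x)) h = 0 := by
    rw [← ME.smulA_left, hz, ME.inner_zero_left, map_zero, zero_apply]
  simpa [hθ, he0] using hb
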